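/- arXiv:2002.00836 — 3 statements merged into one kernel-verified Lean document; each statement's English description precedes it below -/
import Mathlib

section
/- Let (C,V) be an approval election with n = |V| votes, let J ⊆ C be a nonempty set of distinguished candidates, let k ≤ |C| be a positive integer, let ℓ be a nonnegative integer, and let s = max_{c∈J} AV(c) be the maximum AV score of a distinguished candidate. Then it is possible to perform at most ℓ approval additions (each single addition inserts one candidate into one vote not already containing it) so that in the resulting election no candidate of J belongs to any winning k-committee under AV, if and only if s < n and there exist k distinct candidates c_1, …, c_k ∈ C∖J with Σ_{i=1}^{k} max(0, s + 1 − AV(c_i)) ≤ ℓ. -/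
namespace ApprovalBribery

variable {α : Type*} [DecidableEq α]

/-- AV score of a candidate: number of votes approving it. -/
def avScore (V : Multiset (Finset α)) (c : α) : ℕ :=
  (V.map fun v => if c ∈ v then 1 else 0).sum

/-- AV score of a committee. -/
def avCom (V : Multiset (Finset α)) (w : Finset α) : ℕ :=
  (V.map fun v => (v ∩ w).card).sum

/-- SAV score of a candidate. -/
def savScore (V : Multiset (Finset α)) (c : α) : ℚ :=
  (V.map fun v => if c ∈ v then ((v.card : ℚ))⁻¹ else 0).sum

/-- NSAV score of a candidate in an election with candidate set `C`. -/
def nsavScore (C : Finset α) (V : Multiset (Finset α)) (c : α) : ℚ :=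
  savScore V c -
    (V.map fun v => if c ∉ v ∧ v ≠ C then ((C.card : ℚ) - (v.card : ℚ))⁻¹ else 0).sum

/-- SAV score of a committee. -/
def savCom (V : Multiset (Finset α)) (w : Finset α) : ℚ :=
  (V.map fun v => ((v ∩ w).card : ℚ) / (v.card : ℚ)).sum

/-- CCAV score of a committee. -/
def ccavCom (V : Multiset (Finset α)) (w : Finset α) : ℕ :=
  (V.map fun v => if v ∩ w ≠ ∅ then 1 else 0).sum

/-- PAV score of a committee. -/
def pavCom (V : Multiset (Finset α)) (w : Finset α) : ℚ :=
  (V.map fun v => ∑ i ∈ Finset.range (v ∩ w).card, ((i : ℚ) + 1)⁻¹).sum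

/-- `w` is a winning `k`-committee for the scoring function `score` in an election
with candidate set `C`. -/
def IsWinningCommittee {β : Type*} [Preorder β] (C : Finset α) (k : ℕ)
    (score : Finset α → β) (w : Finset α) : Prop :=
  w ⊆ C ∧ w.card = k ∧ ∀ w' ⊆ C, w'.card = k → score w' ≤ score w

/-- `V'` is obtained from `V` by performing at most `ℓ` single approval additions,
each of which inserts one candidate of `C` into one vote not already containing it. -/
def ApprovalAdds (C : Finset α) (V V' : Multiset (Finset α)) (ℓ : ℕ) : Prop :=
  ∃ P : Multiset (Finset α × Finset α),
    V = P.map Prod.fst ∧ V' = P.map Prod.snd ∧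
    (∀ q ∈ P, q.1 ⊆ q.2 ∧ q.2 ⊆ C) ∧
    (P.map fun q => (q.2 \ q.1).card).sum ≤ ℓ

/-- `V'` is obtained from `V` by performing at most `ℓ` single approval deletions,
each of which removes one candidate from one vote containing it. -/
def ApprovalDels (V V' : Multiset (Finset α)) (ℓ : ℕ) : Prop :=
  ∃ P : Multiset (Finset α × Finset α),
    V = P.map Prod.fst ∧ V' = P.map Prod.snd ∧
    (∀ q ∈ P, q.2 ⊆ q.1) ∧
    (P.map fun q => (q.1 \ q.2).card).sum ≤ ℓ

/-- `V'` is obtained from `V` by selecting at most `ℓ` votes and replacing each selected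
vote by an arbitrary vote over `C` within Hamming distance `r` of it. -/
def VoteChanges (C : Finset α) (V V' : Multiset (Finset α)) (ℓ r : ℕ) : Prop :=
  ∃ P : Multiset (Finset α × Finset α),
    V = P.map Prod.fst ∧ V' = P.map Prod.snd ∧
    (∀ q ∈ P, q.1 = q.2 ∨ (q.2 ⊆ C ∧ (q.1 \ q.2).card + (q.2 \ q.1).card ≤ r)) ∧
    P.countP (fun q => q.1 ≠ q.2) ≤ ℓ

/-- `V'` is obtained from `V` by selecting at most `ℓ` votes and replacing each selected
vote `v` by a vote `v'` with `v ⊆ v' ⊆ C` and `|v' \ v| ≤ r`. -/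
def VoteAdditionChanges (C : Finset α) (V V' : Multiset (Finset α)) (ℓ r : ℕ) : Prop :=
  ∃ P : Multiset (Finset α × Finset α),
    V = P.map Prod.fst ∧ V' = P.map Prod.snd ∧
    (∀ q ∈ P, q.1 = q.2 ∨ (q.1 ⊆ q.2 ∧ q.2 ⊆ C ∧ (q.2 \ q.1).card ≤ r)) ∧
    P.countP (fun q => q.1 ≠ q.2) ≤ ℓ

/-- `V'` is obtained from `V` by selecting at most `ℓ` votes and replacing each selected
vote `v` by a vote `v'` with `v' ⊆ v` and `|v \ v'| ≤ r`. -/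
def VoteDeletionChanges (V V' : Multiset (Finset α)) (ℓ r : ℕ) : Prop :=
  ∃ P : Multiset (Finset α × Finset α),
    V = P.map Prod.fst ∧ V' = P.map Prod.snd ∧
    (∀ q ∈ P, q.1 = q.2 ∨ (q.2 ⊆ q.1 ∧ (q.1 \ q.2).card ≤ r)) ∧
    P.countP (fun q => q.1 ≠ q.2) ≤ ℓ

/-- `(X, 𝒞)` is an RX3C instance with `|X| = 3κ`: `𝒞` is a collection of `3κ` many
3-element subsets of `X` and every element of `X` belongs to exactly three members of `𝒞`. -/
def IsRX3C (X : Finset α) (𝒞 : Finset (Finset α)) (κ : ℕ) : Prop :=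
  X.card = 3 * κ ∧ 𝒞.card = 3 * κ ∧ (∀ H ∈ 𝒞, H ⊆ X ∧ H.card = 3) ∧
  ∀ x ∈ X, (𝒞.filter fun H => x ∈ H).card = 3

/-- `𝒞` contains an exact cover of `X`: a subcollection `𝒞' ⊆ 𝒞` such that every element
of `X` belongs to exactly one member of `𝒞'`. -/
def HasExactCover (X : Finset α) (𝒞 : Finset (Finset α)) : Prop :=
  ∃ 𝒞' ⊆ 𝒞, ∀ x ∈ X, (𝒞'.filter fun H => x ∈ H).card = 1

theorem avCom_eq_sum_avScore (V : Multiset (Finset α)) (w : Finset α) :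
    avCom V w = ∑ c ∈ w, avScore V c := by
  induction V using Multiset.induction_on with
  | empty => simp [avCom, avScore]
  | cons v V ih =>
    simp only [avCom, avScore, Multiset.map_cons, Multiset.sum_cons, Finset.sum_add_distrib]
      at ih ⊢
    rw [ih, Finset.sum_boole, Finset.filter_mem_eq_inter, Finset.inter_comm]
    simp

theorem avScore_le_card (V : Multiset (Finset α)) (c : α) : avScore V c ≤ Multiset.card V := by
  induction V using Multiset.induction_on with
  | empty => simp [avScore]
  | cons v V ih =>
    simp only [avScore, Multiset.map_cons, Multiset.sum_cons, Multiset.card_cons] at ih ⊢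
    split_ifs <;> omega

theorem exists_notMem_of_avScore_lt_card (V : Multiset (Finset α)) (c : α)
    (h : avScore V c < Multiset.card V) : ∃ v ∈ V, c ∉ v := by
  contrapose! h
  rw [avScore, Multiset.map_congr rfl fun v hv => if_pos (h v hv)]
  simp

theorem avScore_map_fst_le_snd (P : Multiset (Finset α × Finset α))
    (hP : ∀ q ∈ P, q.1 ⊆ q.2) (c : α) :
    avScore (P.map Prod.fst) c ≤ avScore (P.map Prod.snd) c := by
  simp only [avScore, Multiset.map_map]
  refine Multiset.sum_map_le_sum_map _ _ fun q hq => ?_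
  have := @hP q hq c
  by_cases h : c ∈ q.1 <;> simp_all

theorem avCom_map_snd_le (P : Multiset (Finset α × Finset α)) (w : Finset α) :
    avCom (P.map Prod.snd) w ≤
      avCom (P.map Prod.fst) w + (P.map fun q => (q.2 \ q.1).card).sum := by
  simp only [avCom, Multiset.map_map, ← Multiset.sum_map_add]
  refine Multiset.sum_map_le_sum_map _ _ fun q _ => ?_
  refine (Finset.card_le_card ?_).trans (Finset.card_union_le _ _)
  intro x
  simp only [Finset.mem_inter, Finset.mem_union, Finset.mem_sdiff]
  tauto

/-- A candidate outside a winning committee scores at most as much as any member. -/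
theorem IsWinningCommittee.avScore_le {C : Finset α} {V : Multiset (Finset α)} {k : ℕ}
    {w : Finset α} (hw : IsWinningCommittee C k (avCom V) w) {c t : α} (hc : c ∈ C)
    (hcw : c ∉ w) (ht : t ∈ w) : avScore V c ≤ avScore V t := by
  obtain ⟨hwC, hcard, hmax⟩ := hw
  have hc' : c ∉ w.erase t := fun h => hcw (Finset.mem_of_mem_erase h)
  have h := hmax (insert c (w.erase t))
    (Finset.insert_subset hc ((Finset.erase_subset _ _).trans hwC))
    (by rw [Finset.card_insert_of_notMem hc', Finset.card_erase_add_one ht, hcard])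
  rw [avCom_eq_sum_avScore, avCom_eq_sum_avScore, Finset.sum_insert hc',
    ← Finset.add_sum_erase w _ ht] at h
  omega

theorem exists_isWinningCommittee {β γ : Type*} [LinearOrder β] {C : Finset γ} {k : ℕ}
    (hk : k ≤ C.card) (score : Finset γ → β) : ∃ w, IsWinningCommittee C k score w := by
  obtain ⟨w, hw, hmax⟩ := Finset.exists_max_image (C.powersetCard k) score
    (Finset.powersetCard_nonempty.2 hk)
  rw [Finset.mem_powersetCard] at hw
  exact ⟨w, hw.1, hw.2, fun w' h h' => hmax w' (Finset.mem_powersetCard.2 ⟨h, h'⟩)⟩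

/-- If some vote does not approve `c`, then one more approval of `c` can be added. -/
theorem exists_add_approval {C : Finset α} (P : Multiset (Finset α × Finset α))
    (hP : ∀ q ∈ P, q.1 ⊆ q.2 ∧ q.2 ⊆ C) {c : α} (hc : c ∈ C)
    (h : avScore (P.map Prod.snd) c < Multiset.card P) :
    ∃ P' : Multiset (Finset α × Finset α), P'.map Prod.fst = P.map Prod.fst ∧
      (∀ q ∈ P', q.1 ⊆ q.2 ∧ q.2 ⊆ C) ∧
      avScore (P'.map Prod.snd) c = avScore (P.map Prod.snd) c + 1 ∧
      (∀ d ≠ c, avScore (P'.map Prod.snd) d = avScore (P.map Prod.snd) d) ∧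
      (P'.map fun q => (q.2 \ q.1).card).sum = (P.map fun q => (q.2 \ q.1).card).sum + 1 := by
  obtain ⟨v, hv, hcv⟩ := exists_notMem_of_avScore_lt_card (P.map Prod.snd) c (by simpa using h)
  obtain ⟨q, hq, rfl⟩ := Multiset.mem_map.1 hv
  obtain ⟨R, rfl⟩ := Multiset.exists_cons_of_mem hq
  have hq' := hP q hq
  refine ⟨(q.1, insert c q.2) ::ₘ R, by simp, ?_, ?_, ?_, ?_⟩
  · intro r hr
    rcases Multiset.mem_cons.1 hr with rfl | hr
    · exact ⟨hq'.1.trans (Finset.subset_insert _ _), Finset.insert_subset hc hq'.2⟩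
    · exact hP r (Multiset.mem_cons_of_mem hr)
  · simp [avScore, hcv, add_comm]
  · intro d hd
    simp [avScore, hd]
  · have hc1 : c ∉ q.1 := fun h => hcv (hq'.1 h)
    simp only [Multiset.map_cons, Multiset.sum_cons, Finset.insert_sdiff_of_notMem _ hc1]
    rw [Finset.card_insert_of_notMem (by simp [hcv])]
    omega

/-- The scores of all candidates in `T` can be raised to at least `m`, for any `m` not exceeding
the number of votes, at a total cost equal to the sum of their deficits. -/
theorem exists_raise_scores {C T : Finset α} (hT : T ⊆ C) {m : ℕ} (D : ℕ) :
    ∀ P : Multiset (Finset α × Finset α), m ≤ Multiset.card P →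
      (∀ q ∈ P, q.1 ⊆ q.2 ∧ q.2 ⊆ C) →
      ∑ c ∈ T, (m - avScore (P.map Prod.snd) c) = D →
      ∃ P' : Multiset (Finset α × Finset α), P'.map Prod.fst = P.map Prod.fst ∧
        (∀ q ∈ P', q.1 ⊆ q.2 ∧ q.2 ⊆ C) ∧
        (∀ c ∈ T, m ≤ avScore (P'.map Prod.snd) c) ∧
        (∀ d ∉ T, avScore (P'.map Prod.snd) d = avScore (P.map Prod.snd) d) ∧
        (P'.map fun q => (q.2 \ q.1).card).sum =
          (P.map fun q => (q.2 \ q.1).card).sum + D := by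
  induction D with
  | zero =>
    intro P _ hP hD
    refine ⟨P, rfl, hP, fun c hc => ?_, fun _ _ => rfl, rfl⟩
    have := Finset.sum_eq_zero_iff.1 hD c hc
    omega
  | succ D ih =>
    intro P hm hP hD
    obtain ⟨c, hc, hne⟩ := Finset.exists_ne_zero_of_sum_ne_zero
      (hD.trans_ne D.succ_ne_zero)
    obtain ⟨P₁, hfst, hP₁, hscore, hother, hcost⟩ :=
      exists_add_approval P hP (hT hc) (by omega)
    have hcard : Multiset.card P₁ = Multiset.card P := by
      simpa using congrArg Multiset.card hfst
    have hD₁ : ∑ c ∈ T, (m - avScore (P₁.map Prod.snd) c) = D := by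
      rw [← Finset.add_sum_erase T _ hc] at hD ⊢
      rw [Finset.sum_congr rfl fun d hd => by rw [hother d (Finset.ne_of_mem_erase hd)], hscore]
      omega
    obtain ⟨P', hfst', hP', hT', hother', hcost'⟩ := ih P₁ (by omega) hP₁ hD₁
    refine ⟨P', hfst'.trans hfst, hP', hT', fun d hd => ?_, by omega⟩
    rw [hother' d hd, hother d (ne_of_mem_of_not_mem hc hd).symm]

/-- characterization of destructive bribery by approval additions under AV. -/
theorem appAdd_av_characterization
    (C : Finset α) (V : Multiset (Finset α)) (hV : ∀ v ∈ V, v ⊆ C)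
    (J : Finset α) (hJC : J ⊆ C) (hJ : J.Nonempty)
    (k ℓ : ℕ) (hk : 1 ≤ k) (hkC : k ≤ C.card) :
    (∃ V' : Multiset (Finset α), ApprovalAdds C V V' ℓ ∧
        ∀ w, IsWinningCommittee C k (avCom V') w → ∀ c ∈ J, c ∉ w)
    ↔ (J.sup' hJ (avScore V) < Multiset.card V ∧
        ∃ T ⊆ C \ J, T.card = k ∧
          ∑ c ∈ T, (J.sup' hJ (avScore V) + 1 - avScore V c) ≤ ℓ) := by
  constructor
  · rintro ⟨V', ⟨P, rfl, rfl, hP, hcost⟩, hlose⟩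
    obtain ⟨w, hw⟩ := exists_isWinningCommittee hkC (avCom (P.map Prod.snd))
    have hwJ := hlose w hw
    obtain ⟨j, hj, hjmax⟩ := Finset.exists_mem_eq_sup' hJ (avScore (P.map Prod.fst))
    have hmono := avScore_map_fst_le_snd P fun q hq => (hP q hq).1
    have hbeat : ∀ t ∈ w, avScore (P.map Prod.fst) j + 1 ≤ avScore (P.map Prod.snd) t := by
      intro t ht
      by_contra! hlt
      have hj' : j ∉ w := hwJ j hj
      have hswap : j ∉ w.erase t := fun h => hj' (Finset.mem_of_mem_erase h)
      refine hlose (insert j (w.erase t)) ⟨?_, ?_, fun w' h h' => ?_⟩ j hj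
        (Finset.mem_insert_self _ _)
      · exact Finset.insert_subset (hJC hj) ((Finset.erase_subset _ _).trans hw.1)
      · rw [Finset.card_insert_of_notMem hswap, Finset.card_erase_add_one ht, hw.2.1]
      · refine (hw.2.2 w' h h').trans ?_
        rw [avCom_eq_sum_avScore, avCom_eq_sum_avScore, Finset.sum_insert hswap,
          ← Finset.add_sum_erase w _ ht]
        have := hmono j
        omega
    rw [hjmax]
    refine ⟨?_, w, fun t ht => Finset.mem_sdiff.2 ⟨hw.1 ht, fun h => hwJ t h ht⟩, hw.2.1, ?_⟩
    · obtain ⟨t, ht⟩ := Finset.card_pos.1 (hk.trans_eq hw.2.1.symm)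
      have h₁ := hbeat t ht
      have h₂ := avScore_le_card (P.map Prod.snd) t
      simp only [Multiset.card_map] at h₂ ⊢
      omega
    · have hle : ∑ c ∈ w, (avScore (P.map Prod.fst) j + 1 - avScore (P.map Prod.fst) c) +
          avCom (P.map Prod.fst) w ≤ avCom (P.map Prod.snd) w := by
        rw [avCom_eq_sum_avScore, avCom_eq_sum_avScore, ← Finset.sum_add_distrib]
        refine Finset.sum_le_sum fun t ht => ?_
        have h₁ := hbeat t ht
        have h₂ := hmono t
        omega
      have := avCom_map_snd_le P w
      omega
  · rintro ⟨hs, T, hT, hTk, hcost⟩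
    have hid : (V.map fun v => (v, v)).map Prod.snd = V := by simp
    have hTC : T ⊆ C := hT.trans Finset.sdiff_subset
    obtain ⟨P, hfst, hP, hraise, hother, hsum⟩ := exists_raise_scores hTC
      (m := J.sup' hJ (avScore V) + 1) _ (V.map fun v => (v, v)) (by simpa using hs)
      (by simpa using hV) rfl
    rw [hid] at hother hsum
    refine ⟨P.map Prod.snd, ⟨P, by simpa using hfst.symm, rfl, hP, ?_⟩, fun w hw c hc hcw => ?_⟩
    · simpa [hsum, Function.comp_def] using hcost
    · have hcT : c ∉ T := fun h => (Finset.mem_sdiff.1 (hT h)).2 hc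
      obtain ⟨t, ht, htw⟩ : ∃ t ∈ T, t ∉ w := by
        by_contra! hsub
        exact hcT (Finset.eq_of_subset_of_card_le hsub (by rw [hw.2.1, hTk]) ▸ hcw)
      have h₁ := hw.avScore_le (hTC ht) htw hcw
      have h₂ := hraise t ht
      have h₃ := hother c hcT
      have h₄ := Finset.le_sup' (avScore V) hc
      omega

end ApprovalBribery
end

section
/- Let G = (U,A) be a finite simple d-regular graph with n = |U| vertices and m = |A| edges, and let κ be a positive integer such that κ and n are divisible by 6 and κ² + 2d < 2m. Partition U into n/3 groups U_1, …, U_{n/3}, each of size 3. Consider the approval election with candidate set C = U ∪ {p}, p ∉ U, whose votes are: for each group U_i, (2m − κ² − 2d + 2)/2 votes each equal to U_i, and for each edge {u,u'} ∈ A one vote equal to {u, u', p}. Then it is possible to perform at most κ(κ−1)/2 approval deletions (each single deletion removes one candidate from one vote containing it) so that in the resulting election p belongs to no winning κ-committee under SAV, if and only if G has a clique of size κ. -/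
namespace ApprovalBribery

variable {α : Type*} [DecidableEq α]

/-- Six times the SAV contribution of the vote `v` to the candidate `c`,
exact when `v` has at most three members. -/
def sixthShare (v : Finset α) (c : α) : ℤ :=
  if c ∈ v then 6 / (v.card : ℤ) else 0

/-- Six times the SAV score of `c`, exact when all votes have at most three members. -/
def sixthScore (V : Multiset (Finset α)) (c : α) : ℤ :=
  (V.map fun v => sixthShare v c).sum

theorem cast_sixthScore (V : Multiset (Finset α)) (c : α) (hV : ∀ v ∈ V, v.card ≤ 3) :
    (sixthScore V c : ℚ) = 6 * savScore V c := by
  induction V using Multiset.induction_on with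
  | empty => simp [sixthScore, savScore]
  | cons v V ih =>
    have ih := ih fun v hv => hV v (Multiset.mem_cons_of_mem hv)
    have hv := hV v (Multiset.mem_cons_self v V)
    simp only [sixthScore, savScore, Multiset.map_cons, Multiset.sum_cons, Int.cast_add,
      mul_add] at ih ⊢
    rw [ih]
    congr 1
    unfold sixthShare
    split_ifs
    · interval_cases v.card <;> norm_num
    · simp

theorem savCom_eq_sum_savScore (V : Multiset (Finset α)) (w : Finset α) :
    savCom V w = ∑ c ∈ w, savScore V c := by
  induction V using Multiset.induction_on with
  | empty => simp [savCom, savScore]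
  | cons v V ih =>
    simp only [savCom, savScore, Multiset.map_cons, Multiset.sum_cons,
      Finset.sum_add_distrib] at ih ⊢
    rw [ih, Finset.sum_ite_mem, Finset.sum_const, nsmul_eq_mul, Finset.inter_comm,
      div_eq_mul_inv]

theorem savCom_insert_erase (V : Multiset (Finset α)) {w : Finset α} {p c : α}
    (hc : c ∈ w) (hp : p ∉ w) :
    savCom V (insert p (w.erase c)) = savCom V w + savScore V p - savScore V c := by
  rw [savCom_eq_sum_savScore, savCom_eq_sum_savScore,
    Finset.sum_insert (fun h => hp (Finset.mem_of_mem_erase h)),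
    ← Finset.add_sum_erase w _ hc]
  ring

theorem card_insert_erase {w : Finset α} {p c : α} (hc : c ∈ w) (hp : p ∉ w) :
    (insert p (w.erase c)).card = w.card := by
  rw [Finset.card_insert_of_notMem (fun h => hp (Finset.mem_of_mem_erase h)),
    Finset.card_erase_add_one hc]

/-- A candidate is in no winning `k`-committee iff `k` candidates have a larger SAV score. -/
theorem forall_winning_notMem_iff [Fintype α] (V : Multiset (Finset α)) (p : α) (k : ℕ)
    (hk : k ≤ Fintype.card α) :
    (∀ w, IsWinningCommittee Finset.univ k (savCom V) w → p ∉ w) ↔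
      ∃ W : Finset α, W.card = k ∧ ∀ c ∈ W, savScore V p < savScore V c := by
  constructor
  · intro h
    obtain ⟨w, hw, hmax⟩ := Finset.exists_max_image (Finset.univ.powersetCard k) (savCom V)
      (Finset.powersetCard_nonempty.2 (by simpa using hk))
    have hwk := (Finset.mem_powersetCard.1 hw).2
    have hwin : ∀ w', w'.card = k → savCom V w' ≤ savCom V w := fun w' hw' =>
      hmax w' (Finset.mem_powersetCard.2 ⟨Finset.subset_univ _, hw'⟩)
    have hpw := h w ⟨Finset.subset_univ _, hwk, fun w' _ => hwin w'⟩
    refine ⟨w, hwk, fun c hc => ?_⟩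
    by_contra! hle
    refine h (insert p (w.erase c)) ⟨Finset.subset_univ _, ?_, fun w' _ hw' => ?_⟩
      (Finset.mem_insert_self _ _)
    · rw [card_insert_erase hc hpw, hwk]
    · rw [savCom_insert_erase V hc hpw]
      linarith [hwin w' hw']
  · rintro ⟨W, hW, hlt⟩ w ⟨-, hwk, hmax⟩ hp
    have hpW : p ∉ W := fun h => lt_irrefl _ (hlt p h)
    obtain ⟨c, hcW, hcw⟩ : ∃ c ∈ W, c ∉ w := by
      by_contra! hsub
      exact hpW (Finset.eq_of_subset_of_card_le hsub (by lia) ▸ hp)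
    have := hmax _ (Finset.subset_univ (insert c (w.erase p)))
      (by rw [card_insert_erase hp hcw, hwk])
    rw [savCom_insert_erase V hp hcw] at this
    linarith [hlt c hcW]

theorem sixthScore_add (V V' : Multiset (Finset α)) (c : α) :
    sixthScore (V + V') c = sixthScore V c + sixthScore V' c := by
  simp [sixthScore]

theorem sum_sixthShare (v W : Finset α) :
    ∑ c ∈ W, sixthShare v c = (v ∩ W).card * (6 / (v.card : ℤ)) := by
  simp only [sixthShare]
  rw [Finset.sum_ite_mem, Finset.sum_const, nsmul_eq_mul, Finset.inter_comm]

theorem sum_sixthScore (V : Multiset (Finset α)) (W : Finset α) :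
    ∑ c ∈ W, sixthScore V c = (V.map fun v => ∑ c ∈ W, sixthShare v c).sum :=
  Multiset.sum_map_sum_map W.val V |>.trans rfl

/-- How much deletions in a vote of size three help the members of `W` against `p`. -/
theorem deletion_gain_le {v v' W : Finset α} {p : α} (hv : v.card = 3) (hsub : v' ⊆ v)
    (hp : p ∉ W) (hW : 0 < W.card) :
    (∑ c ∈ W, sixthShare v' c - W.card * sixthShare v' p) ≤
      (∑ c ∈ W, sixthShare v c - W.card * sixthShare v p) +
        ((2 * W.card + 1) * ((v \ v').card : ℤ) +
          if p ∈ v ∧ (v ∩ W).card = 2 then 1 else 0) := by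
  rw [sum_sixthShare, sum_sixthShare, Finset.card_sdiff_of_subset hsub]
  have hs : v'.card ≤ 3 := hv ▸ Finset.card_le_card hsub
  have hba : (v' ∩ W).card ≤ (v ∩ W).card :=
    Finset.card_le_card (Finset.inter_subset_inter_right hsub)
  have hbs : (v' ∩ W).card ≤ v'.card := Finset.card_le_card Finset.inter_subset_left
  have hle : ∀ x : Finset α, p ∈ x → (x ∩ W).card + 1 ≤ x.card := fun x hx => by
    rw [← Finset.card_erase_add_one hx, Nat.add_le_add_iff_right]
    refine Finset.card_le_card fun c hc => ?_
    rw [Finset.mem_inter] at hc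
    exact Finset.mem_erase.2 ⟨fun h => hp (h ▸ hc.2), hc.1⟩
  have ha := hle v
  have hb := hle v'
  have hpp : p ∈ v' → p ∈ v := fun h => hsub h
  have heq : v'.card = 3 → v' = v := fun h => Finset.eq_of_subset_of_card_le hsub (by lia)
  unfold sixthShare
  rw [hv] at ha ⊢
  rcases hs.lt_or_eq with hs | hs
  · generalize (v ∩ W).card = a at *
    generalize (v' ∩ W).card = b at *
    generalize W.card = k at *
    generalize v'.card = s at *
    by_cases h1 : p ∈ v' <;> by_cases h2 : p ∈ v <;> simp only [h1, h2, if_true, if_false,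
      true_and, false_and, forall_const] at * <;> interval_cases s <;>
      norm_num at * <;> (try split_ifs) <;> lia
  · rw [heq hs, hv]
    split_ifs <;> norm_num

/-- How much a bounded number of deletions helps the members of `W` against `p`. -/
theorem sum_sixthScore_le_of_approvalDels {V V' : Multiset (Finset α)} {ℓ : ℕ}
    (hdel : ApprovalDels V V' ℓ) (hV : ∀ v ∈ V, v.card = 3) {W : Finset α} {p : α}
    (hp : p ∉ W) (hW : 0 < W.card) :
    (∑ c ∈ W, sixthScore V' c - W.card * sixthScore V' p) ≤
      (∑ c ∈ W, sixthScore V c - W.card * sixthScore V p) + ((2 * W.card + 1) * ℓ +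
        (V.map fun v => if p ∈ v ∧ (v ∩ W).card = 2 then (1 : ℤ) else 0).sum) := by
  obtain ⟨P, rfl, rfl, hsub, hcost⟩ := hdel
  have hcost' : ((P.map fun q => ((q.1 \ q.2).card : ℤ)).sum) ≤ ℓ := by
    have := Nat.cast_le (α := ℤ).2 hcost
    simpa [Nat.cast_multiset_sum, Function.comp_def] using this
  have h := Multiset.sum_map_le_sum_map _ _ fun q hq =>
    deletion_gain_le (hV q.1 (Multiset.mem_map_of_mem _ hq)) (hsub q hq) hp hW
  simp only [Multiset.sum_map_add, Multiset.sum_map_sub, Multiset.sum_map_mul_left] at h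
  rw [sum_sixthScore, sum_sixthScore]
  simp only [sixthScore, Multiset.map_map, Function.comp_def]
  nlinarith

theorem card_le_of_approvalDels {V V' : Multiset (Finset α)} {ℓ k : ℕ}
    (hdel : ApprovalDels V V' ℓ) (hV : ∀ v ∈ V, v.card ≤ k) : ∀ v ∈ V', v.card ≤ k := by
  obtain ⟨P, rfl, rfl, hsub, -⟩ := hdel
  intro v hv
  obtain ⟨q, hq, rfl⟩ := Multiset.mem_map.1 hv
  exact (Finset.card_le_card (hsub q hq)).trans (hV _ (Multiset.mem_map_of_mem _ hq))

section Election

variable {U : Type*} [DecidableEq U]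

/-- `t` votes for each block of `part`. -/
def blockVotes (part : Finset (Finset U)) (t : ℕ) : Multiset (Finset (U ⊕ Unit)) :=
  part.val.bind fun B => Multiset.replicate t (B.image Sum.inl)

theorem sixthScore_blockVotes (part : Finset (Finset U)) (t : ℕ) (c : U ⊕ Unit) :
    sixthScore (blockVotes part t) c =
      ∑ B ∈ part, t * sixthShare (B.image Sum.inl : Finset (U ⊕ Unit)) c := by
  simp only [sixthScore, blockVotes, Multiset.map_bind, Multiset.sum_bind,
    Multiset.map_replicate, Multiset.sum_replicate, nsmul_eq_mul]
  rfl

theorem sixthScore_blockVotes_inr (part : Finset (Finset U)) (t : ℕ) :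
    sixthScore (blockVotes part t) (Sum.inr ()) = 0 := by
  simp [sixthScore_blockVotes, sixthShare]

theorem sixthScore_blockVotes_inl {part : Finset (Finset U)} (t : ℕ) (u : U)
    (hpart3 : ∀ B ∈ part, B.card = 3)
    (hdisj : (part : Set (Finset U)).PairwiseDisjoint id) (hcov : ∃ B ∈ part, u ∈ B) :
    sixthScore (blockVotes part t) (Sum.inl u) = 2 * t := by
  obtain ⟨B, hB, hu⟩ := hcov
  rw [sixthScore_blockVotes, Finset.sum_eq_single_of_mem B hB]
  · simp [sixthShare, hu, Finset.card_image_of_injective _ Sum.inl_injective, hpart3 B hB,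
      mul_comm]
  · intro B' hB' hne
    have : u ∉ B' := fun h => Finset.disjoint_left.1 (hdisj hB' hB hne) h hu
    simp [sixthShare, this]

theorem card_of_mem_blockVotes {part : Finset (Finset U)} {t : ℕ} {v : Finset (U ⊕ Unit)}
    (hpart3 : ∀ B ∈ part, B.card = 3) (hv : v ∈ blockVotes part t) : v.card = 3 := by
  obtain ⟨B, hB, hv⟩ := Multiset.mem_bind.1 hv
  rw [Multiset.eq_of_mem_replicate hv, Finset.card_image_of_injective _ Sum.inl_injective,
    hpart3 B hB]

theorem inr_notMem_of_mem_blockVotes {part : Finset (Finset U)} {t : ℕ}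
    {v : Finset (U ⊕ Unit)} (hv : v ∈ blockVotes part t) : Sum.inr () ∉ v := by
  obtain ⟨B, hB, hv⟩ := Multiset.mem_bind.1 hv
  simp [Multiset.eq_of_mem_replicate hv]

theorem sum_blockVotes_indicator (part : Finset (Finset U)) (t : ℕ)
    (W : Finset (U ⊕ Unit)) : ((blockVotes part t).map fun v =>
      if Sum.inr () ∈ v ∧ (v ∩ W).card = 2 then (1 : ℤ) else 0).sum = 0 := by
  refine Multiset.sum_eq_zero fun x hx => ?_
  obtain ⟨v, hv, rfl⟩ := Multiset.mem_map.1 hx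
  simp [inr_notMem_of_mem_blockVotes hv]

variable [Fintype U]

/-- The endpoints of `e`, seen as candidates. -/
def endpointVote (e : Sym2 U) : Finset (U ⊕ Unit) :=
  (Finset.univ.filter (· ∈ e)).image Sum.inl

/-- The votes stemming from the edges `E`, after deleting `p` from those belonging to `D`. -/
def edgeVotes (E D : Finset (Sym2 U)) : Multiset (Finset (U ⊕ Unit)) :=
  E.val.map fun e => if e ∈ D then endpointVote e else insert (Sum.inr ()) (endpointVote e)

theorem inr_notMem_endpointVote (e : Sym2 U) : Sum.inr () ∉ endpointVote e := by
  simp [endpointVote]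

theorem inl_mem_endpointVote {e : Sym2 U} {u : U} : Sum.inl u ∈ endpointVote e ↔ u ∈ e := by
  simp [endpointVote]

theorem card_endpointVote {e : Sym2 U} (he : ¬ e.IsDiag) : (endpointVote e).card = 2 := by
  rw [endpointVote, Finset.card_image_of_injective _ Sum.inl_injective,
    ← Sym2.card_toFinset_of_not_isDiag e he]
  congr 1
  ext
  simp

theorem card_insert_endpointVote {e : Sym2 U} (he : ¬ e.IsDiag) :
    (insert (Sum.inr ()) (endpointVote e)).card = 3 := by
  rw [Finset.card_insert_of_notMem (inr_notMem_endpointVote e), card_endpointVote he]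

theorem sixthScore_edgeVotes_inr {E D : Finset (Sym2 U)} (hE : ∀ e ∈ E, ¬ e.IsDiag)
    (hD : D ⊆ E) : sixthScore (edgeVotes E D) (Sum.inr ()) = 2 * E.card - 2 * D.card := by
  have h : sixthScore (edgeVotes E D) (Sum.inr ()) = ∑ e ∈ E, (2 - if e ∈ D then 2 else 0) := by
    rw [sixthScore, edgeVotes, Multiset.map_map]
    refine Finset.sum_congr rfl fun e he => ?_
    by_cases heD : e ∈ D
    · simp [heD, sixthShare, inr_notMem_endpointVote]
    · simp [heD, sixthShare, card_insert_endpointVote (hE e he)]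
  rw [h, Finset.sum_sub_distrib, Finset.sum_ite_mem, Finset.inter_eq_right.2 hD]
  simp [mul_comm]

theorem sixthScore_edgeVotes_inl {E D : Finset (Sym2 U)} (hE : ∀ e ∈ E, ¬ e.IsDiag)
    (hD : D ⊆ E) (u : U) : sixthScore (edgeVotes E D) (Sum.inl u) =
      2 * (E.filter (u ∈ ·)).card + (D.filter (u ∈ ·)).card := by
  have h : sixthScore (edgeVotes E D) (Sum.inl u) =
      ∑ e ∈ E, ((if u ∈ e then 2 else 0) + if e ∈ D then if u ∈ e then 1 else 0 else 0) := by
    rw [sixthScore, edgeVotes, Multiset.map_map]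
    refine Finset.sum_congr rfl fun e he => ?_
    by_cases heD : e ∈ D <;> by_cases hu : u ∈ e <;>
      simp [heD, hu, sixthShare, inl_mem_endpointVote, card_endpointVote (hE e he),
        card_insert_endpointVote (hE e he)]
  rw [h, Finset.sum_add_distrib, Finset.sum_ite_mem, Finset.inter_eq_right.2 hD,
    ← Finset.sum_filter, ← Finset.sum_filter]
  simp [mul_comm]

/-- The edges among `E` with both endpoints in `S`. -/
def edgesInside (E : Finset (Sym2 U)) (S : Finset U) : Finset (Sym2 U) :=
  E.filter fun e => ∀ x ∈ e, x ∈ S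

theorem edgesInside_subset (G : SimpleGraph U) [DecidableRel G.Adj] (S : Finset U) :
    edgesInside G.edgeFinset S ⊆ S.offDiag.image Sym2.mk.uncurry := by
  intro e
  induction e with
  | _ a b =>
    intro h
    simp only [edgesInside, Finset.mem_filter, SimpleGraph.mem_edgeFinset,
      SimpleGraph.mem_edgeSet, Sym2.mem_iff, forall_eq_or_imp, forall_eq] at h
    exact Finset.mem_image.2 ⟨(a, b), Finset.mem_offDiag.2 ⟨h.2.1, h.2.2, h.1.ne⟩, rfl⟩


theorem card_edgesInside_of_clique (G : SimpleGraph U) [DecidableRel G.Adj] {S : Finset U}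
    (hS : ∀ a ∈ S, ∀ b ∈ S, a ≠ b → G.Adj a b) :
    (edgesInside G.edgeFinset S).card = S.card.choose 2 := by
  rw [← Sym2.card_image_offDiag]
  congr 1
  refine (edgesInside_subset G S).antisymm fun e he => ?_
  obtain ⟨⟨a, b⟩, hab, rfl⟩ := Finset.mem_image.1 he
  rw [Finset.mem_offDiag] at hab
  simp [edgesInside, hab.1, hab.2.1, hS a hab.1 b hab.2.1 hab.2.2]

theorem clique_of_choose_le_card_edgesInside (G : SimpleGraph U) [DecidableRel G.Adj]
    {S : Finset U} (hS : S.card.choose 2 ≤ (edgesInside G.edgeFinset S).card) :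
    ∀ a ∈ S, ∀ b ∈ S, a ≠ b → G.Adj a b := by
  intro a ha b hb hab
  have h := Finset.eq_of_subset_of_card_le (edgesInside_subset G S)
    (by rwa [Sym2.card_image_offDiag])
  have hmem : s(a, b) ∈ edgesInside G.edgeFinset S :=
    h ▸ Finset.mem_image.2 ⟨(a, b), Finset.mem_offDiag.2 ⟨ha, hb, hab⟩, rfl⟩
  simpa using (Finset.mem_filter.1 hmem).1

theorem card_le_filter_edgesInside_of_clique (G : SimpleGraph U) [DecidableRel G.Adj]
    {S : Finset U} (hS : ∀ a ∈ S, ∀ b ∈ S, a ≠ b → G.Adj a b) {u : U} (hu : u ∈ S) :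
    S.card ≤ ((edgesInside G.edgeFinset S).filter (u ∈ ·)).card + 1 := by
  rw [← Finset.card_erase_add_one hu, Nat.add_le_add_iff_right]
  refine Finset.card_le_card_of_injOn (fun x => s(u, x)) (fun x hx => ?_)
    fun x _ y _ hxy => Sym2.congr_right.1 hxy
  obtain ⟨hne, hx⟩ := Finset.mem_erase.1 hx
  simp [edgesInside, hu, hx, hS u hu x hx hne.symm]

theorem card_filter_mem_edgeFinset (G : SimpleGraph U) [DecidableRel G.Adj] (u : U) :
    (G.edgeFinset.filter (u ∈ ·)).card = G.degree u := by
  rw [← G.incidenceFinset_eq_filter, G.card_incidenceFinset_eq_degree]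

/-- Deleting `p` from the votes of the edges in `D` costs one deletion per edge. -/
theorem approvalDels_edgeVotes (V : Multiset (Finset (U ⊕ Unit))) {E D : Finset (Sym2 U)}
    (hD : D ⊆ E) : ApprovalDels (V + edgeVotes E ∅) (V + edgeVotes E D) D.card := by
  refine ⟨V.map (fun v => (v, v)) + E.val.map fun e => (insert (Sum.inr ()) (endpointVote e),
    if e ∈ D then endpointVote e else insert (Sum.inr ()) (endpointVote e)), ?_, ?_, ?_, ?_⟩
  · simp [edgeVotes]
  · simp [edgeVotes]
  · intro q hq
    rcases Multiset.mem_add.1 hq with hq | hq <;> obtain ⟨e, -, rfl⟩ := Multiset.mem_map.1 hq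
    · exact subset_rfl
    · dsimp only
      split_ifs
      · exact Finset.subset_insert _ _
      · exact subset_rfl
  · have h : ∀ e : Sym2 U, (insert (Sum.inr ()) (endpointVote e) \
        if e ∈ D then endpointVote e else insert (Sum.inr ()) (endpointVote e)).card =
        if e ∈ D then 1 else 0 := by
      intro e
      split_ifs
      · rw [Finset.insert_sdiff_cancel (inr_notMem_endpointVote e), Finset.card_singleton]
      · simp
    have hsum : ∑ e ∈ E, (if e ∈ D then 1 else 0) = D.card := by
      rw [Finset.sum_ite_mem, Finset.inter_eq_right.2 hD]
      simp
    simp only [Multiset.map_add, Multiset.map_map, Multiset.sum_add, Function.comp_def, h,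
      sdiff_self, Finset.bot_eq_empty, Finset.card_empty]
    simpa using hsum.le

theorem card_of_mem_edgeVotes_empty {E : Finset (Sym2 U)} (hE : ∀ e ∈ E, ¬ e.IsDiag)
    {v : Finset (U ⊕ Unit)} (hv : v ∈ edgeVotes E ∅) : v.card = 3 := by
  obtain ⟨e, he, rfl⟩ := Multiset.mem_map.1 hv
  simpa using card_insert_endpointVote (hE e he)

theorem sum_edgeVotes_indicator_le {E : Finset (Sym2 U)} (hE : ∀ e ∈ E, ¬ e.IsDiag)
    (S : Finset U) : ((edgeVotes E ∅).map fun v =>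
      if Sum.inr () ∈ v ∧ (v ∩ S.image Sum.inl).card = 2 then (1 : ℤ) else 0).sum ≤
        (edgesInside E S).card := by
  rw [edgesInside, Finset.card_filter, Nat.cast_sum, edgeVotes, Multiset.map_map]
  refine Finset.sum_le_sum fun e he => ?_
  by_cases hin : ∀ x ∈ e, x ∈ S
  · rw [if_pos hin, Function.comp_apply]
    split_ifs <;> norm_num
  · have hne : (endpointVote e ∩ S.image Sum.inl).card ≠ 2 := fun h => by
      refine hin fun x hx => ?_
      have heq := Finset.eq_of_subset_of_card_le
        (Finset.inter_subset_left (s₁ := endpointVote e) (s₂ := S.image Sum.inl))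
        (by rw [h, card_endpointVote (hE e he)])
      have := heq ▸ inl_mem_endpointVote.2 hx
      simpa using (Finset.mem_inter.1 this).2
    simp [hin, Finset.insert_inter_of_notMem, hne]

end Election

/-- destructive bribery by at most `κ(κ−1)/2` approval deletions under SAV in the
election built from a `d`-regular graph succeeds (excluding `p` from every winning
`κ`-committee) iff the graph has a clique of size `κ`. -/
theorem appDel_sav_clique {U : Type*} [Fintype U] [DecidableEq U]
    (G : SimpleGraph U) [DecidableRel G.Adj] (d κ : ℕ)
    (hreg : G.IsRegularOfDegree d)
    (hκpos : 0 < κ) (hκ6 : 6 ∣ κ) (hn6 : 6 ∣ Fintype.card U)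
    (hlt : κ ^ 2 + 2 * d < 2 * G.edgeFinset.card)
    (part : Finset (Finset U))
    (hpart3 : ∀ B ∈ part, B.card = 3)
    (hpartdisj : (part : Set (Finset U)).PairwiseDisjoint id)
    (hpartcov : ∀ u : U, ∃ B ∈ part, u ∈ B) :
    (∃ V' : Multiset (Finset (U ⊕ Unit)),
        ApprovalDels
          (part.val.bind (fun B => Multiset.replicate
              ((2 * G.edgeFinset.card - κ ^ 2 - 2 * d + 2) / 2)
              (B.image (Sum.inl : U → U ⊕ Unit)))
            + G.edgeFinset.val.map (fun e =>
                insert (Sum.inr () : U ⊕ Unit)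
                  ((Finset.univ.filter (· ∈ e)).image (Sum.inl : U → U ⊕ Unit))))
          V' (κ * (κ - 1) / 2) ∧
        ∀ w, IsWinningCommittee Finset.univ κ (savCom V') w →
          (Sum.inr () : U ⊕ Unit) ∉ w)
    ↔ ∃ S : Finset U, S.card = κ ∧ ∀ a ∈ S, ∀ b ∈ S, a ≠ b → G.Adj a b := by
  set E := G.edgeFinset
  obtain ⟨h, rfl⟩ := hκ6
  have hE : ∀ e ∈ E, ¬ e.IsDiag := fun e he =>
    G.not_isDiag_of_mem_edgeSet (SimpleGraph.mem_edgeFinset.1 he)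
  have hcard : 6 * h ≤ Fintype.card (U ⊕ Unit) := by
    have hm : E.card ≤ (Fintype.card U).choose 2 := G.card_edgeFinset_le_card_choose_two
    rw [Nat.choose_two_right] at hm
    have hle : Fintype.card U * (Fintype.card U - 1) ≤ Fintype.card U * Fintype.card U :=
      Nat.mul_le_mul_left _ (Nat.sub_le _ _)
    rw [Fintype.card_sum, Fintype.card_unit]
    by_contra! hlt'
    nlinarith [Nat.div_mul_le_self (Fintype.card U * (Fintype.card U - 1)) 2]
  have hchoose : ((6 * h * (6 * h - 1) / 2 : ℕ) : ℤ) = 3 * h * (6 * h - 1) := by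
    obtain ⟨k, rfl⟩ : ∃ k, h = k + 1 := ⟨h - 1, by lia⟩
    rw [show 6 * (k + 1) * (6 * (k + 1) - 1) = 2 * (3 * (k + 1) * (6 * k + 5)) by
      rw [show 6 * (k + 1) - 1 = 6 * k + 5 by lia]; ring, Nat.mul_div_cancel_left _ two_pos]
    push_cast
    ring
  obtain ⟨t, ht⟩ : ∃ t, t = (2 * E.card - (6 * h) ^ 2 - 2 * d + 2) / 2 := ⟨_, rfl⟩
  have ht' : (t : ℤ) = E.card - 18 * (h : ℤ) ^ 2 - d + 1 := by
    have h36 : (6 * h) ^ 2 = 36 * h ^ 2 := by ring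
    rw [h36] at ht hlt
    zify at ht hlt ⊢
    lia
  rw [← ht]
  have hV : (part.val.bind (fun B => Multiset.replicate t (B.image Sum.inl)) +
      E.val.map fun e => insert (Sum.inr () : U ⊕ Unit)
        ((Finset.univ.filter (· ∈ e)).image (Sum.inl : U → U ⊕ Unit))) =
      blockVotes part t + edgeVotes E ∅ := by
    simp [blockVotes, edgeVotes, endpointVote]
  rw [hV]
  have hV3 : ∀ v ∈ blockVotes part t + edgeVotes E ∅, v.card = 3 := fun v hv =>
    (Multiset.mem_add.1 hv).elim (card_of_mem_blockVotes hpart3)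
      (card_of_mem_edgeVotes_empty hE)
  have hinl : ∀ D ⊆ E, ∀ u, sixthScore (blockVotes part t + edgeVotes E D) (Sum.inl u) =
      2 * t + 2 * d + (D.filter (u ∈ ·)).card := fun D hD u => by
    rw [sixthScore_add, sixthScore_blockVotes_inl t u hpart3 hpartdisj (hpartcov u),
      sixthScore_edgeVotes_inl hE hD, card_filter_mem_edgeFinset, hreg u, add_assoc]
  have hinr : ∀ D ⊆ E, sixthScore (blockVotes part t + edgeVotes E D) (Sum.inr ()) =
      2 * E.card - 2 * D.card := fun D hD => by
    rw [sixthScore_add, sixthScore_blockVotes_inr, sixthScore_edgeVotes_inr hE hD, zero_add]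
  simp only [forall_winning_notMem_iff _ _ _ hcard]
  have hlt_iff : ∀ V' ℓ, ApprovalDels (blockVotes part t + edgeVotes E ∅) V' ℓ → ∀ c,
      savScore V' (Sum.inr ()) < savScore V' c ↔
        sixthScore V' (Sum.inr ()) < sixthScore V' c := fun V' ℓ hdel c => by
    have h3 := card_le_of_approvalDels hdel fun v hv => (hV3 v hv).le
    rw [← Int.cast_lt (R := ℚ), cast_sixthScore _ _ h3, cast_sixthScore _ _ h3,
      mul_lt_mul_iff_right₀ (by norm_num)]
  constructor
  · rintro ⟨V', hdel, W, hW, hgt⟩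
    have hp : Sum.inr () ∉ W := fun h => lt_irrefl _ (hgt _ h)
    obtain ⟨S, rfl⟩ : ∃ S : Finset U, W = S.image Sum.inl := by
      refine ⟨Finset.univ.filter (Sum.inl · ∈ W), ?_⟩
      ext (u | u)
      · simp
      · simpa using hp
    have hS : S.card = 6 * h := by
      rwa [Finset.card_image_of_injective _ Sum.inl_injective] at hW
    refine ⟨S, hS, clique_of_choose_le_card_edgesInside G ?_⟩
    have hgain := sum_sixthScore_le_of_approvalDels hdel hV3 hp (hW ▸ hκpos)
    have hbase : ∑ c ∈ S.image (Sum.inl : U → U ⊕ Unit),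
        sixthScore (blockVotes part t + edgeVotes E ∅) c = 6 * h * (2 * t + 2 * d) := by
      simp [Finset.sum_image, Sum.inl_injective.injOn, hinl ∅ (Finset.empty_subset _), hS]
    have hnew : ∑ c ∈ S.image (Sum.inl : U → U ⊕ Unit), (sixthScore V' (Sum.inr ()) + 1) ≤
        ∑ c ∈ S.image (Sum.inl : U → U ⊕ Unit), sixthScore V' c :=
      Finset.sum_le_sum fun c hc => (hlt_iff V' _ hdel c).1 (hgt c hc)
    rw [Finset.sum_const, hW, nsmul_eq_mul] at hnew
    rw [hbase, hinr ∅ (Finset.empty_subset _), Multiset.map_add, Multiset.sum_add,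
      sum_blockVotes_indicator, hW, hchoose, ht'] at hgain
    have hind := sum_edgeVotes_indicator_le hE S
    rw [hS, Nat.choose_two_right]
    zify [hchoose]
    push_cast at *
    simp only [Finset.card_empty, Nat.cast_zero] at hgain
    nlinarith
  · rintro ⟨S, hS, hclique⟩
    have hD := card_edgesInside_of_clique G hclique
    have hDE : edgesInside E S ⊆ E := Finset.filter_subset _ _
    rw [hS, Nat.choose_two_right] at hD
    have hdel := approvalDels_edgeVotes (blockVotes part t) hDE
    rw [hD] at hdel
    refine ⟨_, hdel, S.image Sum.inl, ?_, fun c hc => (hlt_iff _ _ hdel c).2 ?_⟩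
    · rw [Finset.card_image_of_injective _ Sum.inl_injective, hS]
    · obtain ⟨u, hu, rfl⟩ := Finset.mem_image.1 hc
      have hdeg := card_le_filter_edgesInside_of_clique G hclique hu
      rw [hinl _ hDE, hinr _ hDE, hD, hchoose, ht']
      rw [hS] at hdeg
      zify at hdeg
      nlinarith

end ApprovalBribery
end

section
/- Let (X,𝒞) be an RX3C instance with |X| = 3κ, where κ ≥ 3, and let r ≥ 4 be an integer. Consider the approval election with candidate set C = X ∪ {p}, p ∉ X, whose votes are: for each x ∈ X, κ−3 votes each equal to {x}, and for each H ∈ 𝒞 one vote equal to H. Then it is possible to select at most κ votes and replace each selected vote v by an arbitrary vote v' ⊆ C with Hamming distance |v∖v'| + |v'∖v| ≤ r, so that in the resulting election no candidate of X belongs to any winning 1-committee under AV, if and only if 𝒞 contains an exact cover of X. -/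
namespace ApprovalBribery

variable {α : Type*} [DecidableEq α]

theorem avCom_singleton (V : Multiset (Finset α)) (c : α) :
    avCom V {c} = V.countP (fun v => c ∈ v) := by
  unfold avCom
  induction V using Multiset.induction_on with
  | empty => simp
  | cons a s ih =>
    rw [Multiset.map_cons, Multiset.sum_cons, ih, Multiset.countP_cons, add_comm]
    by_cases h : c ∈ a <;> simp [h]

theorem countP_le_countP_of_imp {β : Type*} (s : Multiset β) (P Q : β → Prop)
    [DecidablePred P] [DecidablePred Q] (h : ∀ a ∈ s, P a → Q a) :
    s.countP P ≤ s.countP Q := by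
  induction s using Multiset.induction_on with
  | empty => simp
  | cons a s ih =>
    have hs := ih fun b hb => h b (Multiset.mem_cons_of_mem hb)
    have ha := h a (Multiset.mem_cons_self a s)
    simp only [Multiset.countP_cons]
    split_ifs <;> first | omega | tauto

/-- Double counting of the incidences between candidates and votes. -/
theorem sum_countP_mem (X : Finset α) (M : Multiset (Finset α)) :
    ∑ x ∈ X, M.countP (fun v => x ∈ v) = (M.map fun v => (X ∩ v).card).sum := by
  induction M using Multiset.induction_on with
  | empty => simp
  | cons a s ih =>
    simp only [Multiset.countP_cons, Finset.sum_add_distrib, ih, Multiset.map_cons,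
      Multiset.sum_cons, Finset.sum_boole, Finset.filter_mem_eq_inter]
    simp [add_comm]

theorem sum_map_le_mul_card {β : Type*} (M : Multiset β) (f : β → ℕ) (n : ℕ)
    (h : ∀ v ∈ M, f v ≤ n) : (M.map f).sum ≤ n * M.card := by
  simpa [mul_comm] using Multiset.sum_le_card_nsmul (M.map f) n (by simpa using h)

theorem countP_val_eq_card_filter (𝒞 : Finset (Finset α)) (x : α) :
    𝒞.val.countP (fun v => x ∈ v) = (𝒞.filter fun H => x ∈ H).card := by
  rw [Multiset.countP_eq_card_filter]; rfl

theorem countP_bind_replicate_singleton (X : Finset α) (n : ℕ) {x : α} (hx : x ∈ X) :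
    (X.val.bind fun y => Multiset.replicate n ({y} : Finset α)).countP (fun v => x ∈ v) = n := by
  have h : ∀ y : α, (Multiset.replicate n ({y} : Finset α)).countP (fun v => x ∈ v) =
      if x = y then n else 0 := by
    intro y
    induction n with
    | zero => simp
    | succ k ih =>
      rw [Multiset.replicate_succ, Multiset.countP_cons, ih]
      by_cases hxy : x = y <;> simp [hxy]
  rw [Multiset.countP_eq_card_filter, Multiset.filter_bind, Multiset.card_bind]
  simp only [Function.comp_def, ← Multiset.countP_eq_card_filter, h]
  change ∑ y ∈ X, (if x = y then n else 0) = n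
  simp [hx]

theorem countP_rx3c_election {X : Finset α} {𝒞 : Finset (Finset α)} {κ : ℕ} (hκ : 3 ≤ κ)
    (hR : IsRX3C X 𝒞 κ) {x : α} (hx : x ∈ X) :
    (X.val.bind (fun x => Multiset.replicate (κ - 3) {x}) + 𝒞.val).countP
      (fun v => x ∈ v) = κ := by
  rw [Multiset.countP_add, countP_bind_replicate_singleton X _ hx, countP_val_eq_card_filter,
    hR.2.2.2 x hx]
  omega

/-- No candidate of `X` wins exactly when the only other candidate beats all of `X`. -/
theorem forall_winning_notMem_iff_s7 (X : Finset α) (p : α)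
    (score : Finset α → ℕ) :
    (∀ w, IsWinningCommittee (insert p X) 1 score w → ∀ x ∈ X, x ∉ w) ↔
      ∀ x ∈ X, score {x} < score {p} := by
  constructor
  · intro h x hx
    by_contra! hle
    obtain ⟨c, hc, hmax⟩ := Finset.exists_max_image (insert p X) (fun c => score {c})
      ⟨p, Finset.mem_insert_self p X⟩
    have hwin : ∀ y ∈ insert p X, score {c} ≤ score {y} →
        IsWinningCommittee (insert p X) 1 score {y} := by
      refine fun y hy hcy => ⟨Finset.singleton_subset_iff.2 hy, Finset.card_singleton y, ?_⟩
      intro w' hw' hcard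
      obtain ⟨z, rfl⟩ := Finset.card_eq_one.1 hcard
      exact (hmax z (Finset.singleton_subset_iff.1 hw')).trans hcy
    rcases Finset.mem_insert.1 hc with rfl | hcX
    · exact h {x} (hwin x (Finset.mem_insert_of_mem hx) hle) x hx (Finset.mem_singleton_self x)
    · exact h {c} (hwin c hc le_rfl) c hcX (Finset.mem_singleton_self c)
  · rintro h w ⟨-, hcard, hmax⟩ x hx hxw
    obtain ⟨z, rfl⟩ := Finset.card_eq_one.1 hcard
    obtain rfl := Finset.mem_singleton.1 hxw
    have := hmax {p} (by simp) (Finset.card_singleton p)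
    exact (h x hx).not_ge this

/-- A multiset of at most `κ` votes of size at most three that covers a set of `3κ` candidates
consists of triples and covers every candidate exactly once. -/
theorem exact_of_covering {X : Finset α} {κ : ℕ} (hX : X.card = 3 * κ)
    {M : Multiset (Finset α)} (hM : M.card ≤ κ) (h3 : ∀ v ∈ M, v.card ≤ 3)
    (hcov : ∀ x ∈ X, 1 ≤ M.countP (fun v => x ∈ v)) :
    (∀ v ∈ M, v.card = 3) ∧ ∀ x ∈ X, M.countP (fun v => x ∈ v) = 1 := by
  have hle : ∀ v ∈ M, (X ∩ v).card ≤ 3 := fun v hv =>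
    (Finset.card_le_card Finset.inter_subset_right).trans (h3 v hv)
  have hsum := sum_countP_mem X M
  have hup := sum_map_le_mul_card M (fun v => (X ∩ v).card) 3 hle
  have hlow : ∑ x ∈ X, 1 ≤ ∑ x ∈ X, M.countP (fun v => x ∈ v) := Finset.sum_le_sum hcov
  have hone : ∑ x ∈ X, 1 = 3 * κ := by simp [hX]
  constructor
  · intro v hv
    obtain ⟨M', rfl⟩ := Multiset.exists_cons_of_mem hv
    have hup' := sum_map_le_mul_card M' (fun v => (X ∩ v).card) 3
      fun u hu => hle u (Multiset.mem_cons_of_mem hu)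
    have hXv := Finset.card_le_card (Finset.inter_subset_right (s₁ := X) (s₂ := v))
    have hv3 := h3 v hv
    simp only [Multiset.map_cons, Multiset.sum_cons, Multiset.card_cons] at hsum hM
    omega
  · have heq : ∑ x ∈ X, 1 = ∑ x ∈ X, M.countP (fun v => x ∈ v) := by omega
    exact fun x hx => ((Finset.sum_eq_sum_iff_of_le hcov).1 heq x hx).symm

theorem hasExactCover_of_multiset {X : Finset α} {𝒞 : Finset (Finset α)}
    {M : Multiset (Finset α)} (hM : ∀ v ∈ M, v ∈ 𝒞)
    (h1 : ∀ x ∈ X, M.countP (fun v => x ∈ v) = 1) : HasExactCover X 𝒞 := by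
  refine ⟨M.toFinset, fun v hv => hM v (Multiset.mem_toFinset.1 hv), fun x hx => ?_⟩
  have hx1 := h1 x hx
  apply le_antisymm
  · rw [← Multiset.toFinset_filter, ← hx1, Multiset.countP_eq_card_filter]
    exact Multiset.toFinset_card_le _
  · obtain ⟨v, hv, hxv⟩ := Multiset.countP_pos.1 (hx1 ▸ Nat.one_pos)
    exact Finset.card_pos.2 ⟨v, by simp [hv, hxv]⟩

theorem hasExactCover_of_voteChanges {X : Finset α} {𝒞 : Finset (Finset α)} {κ r : ℕ}
    (hκ : 3 ≤ κ) (hR : IsRX3C X 𝒞 κ) {p : α} (hp : p ∉ X) {V' : Multiset (Finset α)}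
    (hV : VoteChanges (insert p X)
      (X.val.bind (fun x => Multiset.replicate (κ - 3) {x}) + 𝒞.val) V' κ r)
    (hwin : ∀ x ∈ X, avCom V' {x} < avCom V' {p}) : HasExactCover X 𝒞 := by
  obtain ⟨P, hP, rfl, -, hcount⟩ := hV
  have hvote : ∀ q ∈ P, (∃ x ∈ X, q.1 = {x}) ∨ q.1 ∈ 𝒞 := by
    intro q hq
    have := hP ▸ Multiset.mem_map_of_mem Prod.fst hq
    rcases Multiset.mem_add.1 this with h | h
    · obtain ⟨x, hx, hqx⟩ := Multiset.mem_bind.1 h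
      exact Or.inl ⟨x, hx, Multiset.eq_of_mem_replicate hqx⟩
    · exact Or.inr h
  have hpq : ∀ q ∈ P, p ∉ q.1 := by
    intro q hq hpq
    rcases hvote q hq with ⟨x, hx, h⟩ | h
    · rw [h, Finset.mem_singleton] at hpq
      exact hp (hpq ▸ hx)
    · exact hp ((hR.2.2.1 _ h).1 hpq)
  have hpscore : (P.map Prod.snd).countP (fun v => p ∈ v) ≤ κ := by
    rw [Multiset.countP_map, ← Multiset.countP_eq_card_filter]
    refine (countP_le_countP_of_imp P _ _ fun q hq hq2 heq => ?_).trans hcount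
    exact hpq q hq (heq ▸ hq2)
  set M := (P.filter fun q => q.1 ≠ q.2).map Prod.fst with hMdef
  have hMcard : M.card ≤ κ := by
    rw [hMdef, Multiset.card_map, ← Multiset.countP_eq_card_filter]
    exact hcount
  have hMvote : ∀ v ∈ M, (∃ x ∈ X, v = {x}) ∨ v ∈ 𝒞 := by
    intro v hv
    obtain ⟨q, hq, rfl⟩ := Multiset.mem_map.1 hv
    exact hvote q (Multiset.mem_of_mem_filter hq)
  have hcov : ∀ x ∈ X, 1 ≤ M.countP (fun v => x ∈ v) := by
    intro x hx
    by_contra! hlt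
    have hnone := Multiset.countP_eq_zero.1 (Nat.lt_one_iff.1 hlt)
    have hkeep : (P.map Prod.fst).countP (fun v => x ∈ v) ≤
        (P.map Prod.snd).countP (fun v => x ∈ v) := by
      simp only [Multiset.countP_map, ← Multiset.countP_eq_card_filter]
      refine countP_le_countP_of_imp P _ _ fun q hq hq1 => ?_
      by_cases heq : q.1 = q.2
      · exact heq ▸ hq1
      · exact absurd hq1
          (hnone q.1 (Multiset.mem_map_of_mem _ (Multiset.mem_filter.2 ⟨hq, heq⟩)))
    rw [← hP, countP_rx3c_election hκ hR hx] at hkeep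
    have := hwin x hx
    rw [avCom_singleton, avCom_singleton] at this
    omega
  obtain ⟨hthree, hone⟩ := exact_of_covering hR.1 hMcard
    (fun v hv => by
      rcases hMvote v hv with ⟨x, -, rfl⟩ | h
      · simp
      · exact (hR.2.2.1 v h).2.le) hcov
  refine hasExactCover_of_multiset (fun v hv => ?_) hone
  rcases hMvote v hv with ⟨x, -, rfl⟩ | h
  · simpa using hthree _ hv
  · exact h

theorem card_of_exact {X : Finset α} {𝒞' : Finset (Finset α)} {κ : ℕ} (hX : X.card = 3 * κ)
    (hsub : ∀ H ∈ 𝒞', H ⊆ X ∧ H.card = 3)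
    (hex : ∀ x ∈ X, (𝒞'.filter fun H => x ∈ H).card = 1) : 𝒞'.card = κ := by
  have h := sum_countP_mem X 𝒞'.val
  simp only [countP_val_eq_card_filter] at h
  rw [Finset.sum_congr rfl hex] at h
  have h2 : ∑ H ∈ 𝒞', (X ∩ H).card = ∑ H ∈ 𝒞', 3 :=
    Finset.sum_congr rfl fun H hH => by
      rw [Finset.inter_eq_right.2 (hsub H hH).1, (hsub H hH).2]
  change _ = ∑ H ∈ 𝒞', (X ∩ H).card at h
  rw [h2] at h
  simp only [Finset.sum_const, smul_eq_mul] at h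
  omega

theorem exists_voteChanges_of_exactCover {X : Finset α} {𝒞 : Finset (Finset α)} {κ r : ℕ}
    (hκ : 3 ≤ κ) (hr : 4 ≤ r) (hR : IsRX3C X 𝒞 κ) {p : α} (hp : p ∉ X)
    (h : HasExactCover X 𝒞) :
    ∃ V' : Multiset (Finset α), VoteChanges (insert p X)
        (X.val.bind (fun x => Multiset.replicate (κ - 3) {x}) + 𝒞.val) V' κ r ∧
      ∀ x ∈ X, avCom V' {x} < avCom V' {p} := by
  obtain ⟨𝒞', hsub, hex⟩ := h
  have hcard := card_of_exact hR.1 (fun H hH => hR.2.2.1 H (hsub hH)) hex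
  set U := X.val.bind (fun x => Multiset.replicate (κ - 3) ({x} : Finset α)) with hU
  have hval : 𝒞.val = (𝒞 \ 𝒞').val + 𝒞'.val := by
    rw [Finset.sdiff_val, tsub_add_cancel_of_le (Finset.val_le_iff.2 hsub)]
  set R := U + (𝒞 \ 𝒞').val with hRdef
  have hsplit : U + 𝒞.val = R + 𝒞'.val := by rw [hval, hRdef, add_assoc]
  refine ⟨R + Multiset.replicate κ {p}, ⟨R.map (fun v => (v, v)) + 𝒞'.val.map (fun v => (v, {p})),
    ?_, ?_, ?_, ?_⟩, fun x hx => ?_⟩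
  · simpa [Multiset.map_map, Function.comp_def] using hsplit
  · simp [Multiset.map_map, hcard]
  · intro q hq
    rcases Multiset.mem_add.1 hq with hq | hq
    · obtain ⟨v, -, rfl⟩ := Multiset.mem_map.1 hq
      exact Or.inl rfl
    · obtain ⟨v, hv, rfl⟩ := Multiset.mem_map.1 hq
      refine Or.inr ⟨by simp, ?_⟩
      have h3 := (hR.2.2.1 v (hsub hv)).2
      have h1 := Finset.card_le_card (Finset.sdiff_subset (s := v) (t := {p}))
      have h2 := Finset.card_le_card (Finset.sdiff_subset (s := {p}) (t := v))
      rw [Finset.card_singleton] at h2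
      dsimp only
      omega
  · rw [Multiset.countP_add]
    have h0 : (R.map fun v => (v, v)).countP (fun q : Finset α × Finset α => q.1 ≠ q.2) = 0 := by
      simp [Multiset.countP_eq_zero]
    have h1 := Multiset.countP_le_card (fun q : Finset α × Finset α => q.1 ≠ q.2)
      (𝒞'.val.map fun v => (v, {p}))
    rw [Multiset.card_map] at h1
    change _ ≤ 𝒞'.card at h1
    omega
  · have hscore := countP_rx3c_election hκ hR hx
    rw [← hU, hsplit, Multiset.countP_add, countP_val_eq_card_filter, hex x hx] at hscore
    have hxp : x ≠ p := fun h => hp (h ▸ hx)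
    have hx0 : (Multiset.replicate κ ({p} : Finset α)).countP (fun v => x ∈ v) = 0 := by
      refine Multiset.countP_eq_zero.2 fun v hv => ?_
      rw [Multiset.eq_of_mem_replicate hv, Finset.mem_singleton]
      exact hxp
    have hpκ : (Multiset.replicate κ ({p} : Finset α)).countP (fun v => p ∈ v) = κ := by
      have := Multiset.countP_eq_card (p := fun v => p ∈ v)
        (s := Multiset.replicate κ ({p} : Finset α))
      rw [Multiset.card_replicate] at this
      refine this.2 fun v hv => ?_
      rw [Multiset.eq_of_mem_replicate hv]
      exact Finset.mem_singleton_self p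
    rw [avCom_singleton, avCom_singleton, Multiset.countP_add _ R, Multiset.countP_add _ R, hx0, hpκ]
    omega

/-- destructive bribery by changing at most `κ` votes (each within Hamming
distance `r ≥ 4`) under AV in the election built from an RX3C instance succeeds iff the
instance has an exact cover. -/
theorem vc_av_rx3c
    (X : Finset α) (𝒞 : Finset (Finset α)) (κ r : ℕ)
    (hκ : 3 ≤ κ) (hr : 4 ≤ r) (hR : IsRX3C X 𝒞 κ)
    (p : α) (hp : p ∉ X) :
    (∃ V' : Multiset (Finset α),
        VoteChanges (insert p X)
          (X.val.bind (fun x => Multiset.replicate (κ - 3) {x}) + 𝒞.val) V' κ r ∧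
        ∀ w, IsWinningCommittee (insert p X) 1 (avCom V') w → ∀ x ∈ X, x ∉ w)
    ↔ HasExactCover X 𝒞 := by
  simp only [forall_winning_notMem_iff_s7 X p]
  exact ⟨fun ⟨_, hV, hwin⟩ => hasExactCover_of_voteChanges hκ hR hp hV hwin,
    exists_voteChanges_of_exactCover hκ hr hR hp⟩

end ApprovalBribery
end
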